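/- (Clifford's theorem for abelian normal subgroups) Let G be a finite group, N an abelian normal subgroup, and ρ an irreducible complex representation of G on V. For χ in the dual of N, let V_χ = {v ∈ V : ρ(n)v = χ(n)v for all n ∈ N}. Then the set of χ with V_χ ≠ 0 is a single orbit under the action of G on the dual of N given by (ᵍχ)(n) = χ(g⁻¹ng). -/

import Mathlib

/-- A representation is irreducible: the space is nonzero and the only invariant
submodules are `⊥` and `⊤`. -/
def IsIrrep {G : Type} [Monoid G] {V : Type} [AddCommGroup V] [Module ℂ V]
    (ρ : Representation ℂ G V) : Prop :=
  (∃ v : V, v ≠ 0) ∧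
  ∀ W : Submodule ℂ V, (∀ (g : G) (v : V), v ∈ W → ρ g v ∈ W) → W = ⊥ ∨ W = ⊤

/-- A commuting finite family has a joint eigenvector, giving a character. -/
theorem exists_joint_char (G : Type) [Group G] (N : Subgroup G)
    (hab : ∀ a b : N, a * b = b * a) (V : Type) [AddCommGroup V]
    [Module ℂ V] [FiniteDimensional ℂ V] (ρ : Representation ℂ G V)
    (hV : ∃ v : V, v ≠ 0) :
    ∃ χ₀ : N →* ℂˣ, ∃ v : V, v ≠ 0 ∧ ∀ n : N, ρ ↑n v = (χ₀ n : ℂ) • v := by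
  obtain ⟨u, hu⟩ := hV
  let S : Set (Submodule ℂ V) := {W | W ≠ ⊥ ∧ ∀ n : N, ∀ v ∈ W, ρ n v ∈ W}
  have hS : S.Nonempty := by
    refine ⟨⊤, ?_, fun _ _ _ => Submodule.mem_top⟩
    intro h
    exact hu ((Submodule.mem_bot ℂ).1 (h ▸ Submodule.mem_top))
  obtain ⟨W, ⟨hW0, hWi⟩, hmin⟩ :=
    (wellFounded_lt : WellFounded ((· < ·) : Submodule ℂ V → Submodule ℂ V → Prop)).has_min S hS
  have hsc : ∀ n : N, ∃ c : ℂ, ∀ v ∈ W, ρ n v = c • v := by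
    intro n
    haveI : Nontrivial W := (Submodule.nontrivial_iff_ne_bot).2 hW0
    obtain ⟨c, hc⟩ := Module.End.exists_eigenvalue ((ρ n).restrict (hWi n))
    obtain ⟨w, hw⟩ := hc.exists_hasEigenvector
    have hw1 : ρ n (w : V) = c • (w : V) := by
      have := congrArg Subtype.val hw.apply_eq_smul
      simpa using this
    have hw2 : (w : V) ≠ 0 := fun h => hw.2 (Subtype.ext h)
    refine ⟨c, ?_⟩
    let W' : Submodule ℂ V := W ⊓ Module.End.eigenspace (ρ n) c
    have hW' : W' ∈ S := by
      refine ⟨?_, ?_⟩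
      · intro h
        have : (w : V) ∈ W' := ⟨w.2, Module.End.mem_eigenspace_iff.2 hw1⟩
        rw [h] at this
        exact hw2 ((Submodule.mem_bot ℂ).1 this)
      · rintro m v ⟨hv1, hv2⟩
        refine ⟨hWi m v hv1, Module.End.mem_eigenspace_iff.2 ?_⟩
        have hv3 := Module.End.mem_eigenspace_iff.1 hv2
        have hc : (n : G) * m = m * n := congrArg Subtype.val (hab n m)
        rw [← Module.End.mul_apply, ← map_mul, hc, map_mul, Module.End.mul_apply, hv3, map_smul]
    have hle : W' ≤ W := inf_le_left
    have heq : W' = W := by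
      by_contra hne
      exact hmin W' hW' (lt_of_le_of_ne hle hne)
    intro v hv
    rw [← heq] at hv
    exact Module.End.mem_eigenspace_iff.1 hv.2
  obtain ⟨w, hw, hw0⟩ := W.ne_bot_iff.1 hW0
  choose c hc using hsc
  let f : N →* ℂ :=
    { toFun := c
      map_one' := by
        apply smul_left_injective ℂ hw0
        simp [← hc 1 w hw]
      map_mul' := by
        intro a b
        apply smul_left_injective ℂ hw0
        change c (a * b) • w = (c a * c b) • w
        rw [← hc _ w hw, Subgroup.coe_mul, map_mul, Module.End.mul_apply, hc b w hw, map_smul,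
          hc a w hw, smul_smul, mul_comm] }
  refine ⟨f.toHomUnits, w, hw0, fun n => ?_⟩
  rw [hc n w hw]
  rfl

/-- Clifford's theorem for an abelian normal subgroup `N ⊴ G`: for an irreducible
representation `ρ` of `G`, the set of characters `χ` of `N` whose eigenspace
`V_χ = {v | ρ n v = χ n • v}` is nonzero is a single orbit under the `G`-action
`(ᵍχ) n = χ (g⁻¹ n g)`. -/
theorem clifford_single_orbit (G : Type) [Group G] [Finite G] (N : Subgroup G)
    (hN : N.Normal) (hab : ∀ a b : N, a * b = b * a) (V : Type) [AddCommGroup V]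
    [Module ℂ V] [FiniteDimensional ℂ V] (ρ : Representation ℂ G V)
    (hirr : IsIrrep ρ) :
    ∃ χ₀ : N →* ℂˣ,
      {χ : N →* ℂˣ | ∃ v : V, v ≠ 0 ∧ ∀ n : N, ρ ↑n v = (χ n : ℂ) • v} =
      {χ : N →* ℂˣ | ∃ g : G, ∀ n : N,
          χ n = χ₀ ⟨g⁻¹ * ↑n * g, by simpa using hN.conj_mem _ n.2 g⁻¹⟩} := by
  classical
  obtain ⟨χ₀, v₀, hv₀, hχ₀⟩ := exists_joint_char G N hab V ρ hirr.1
  have key : ∀ (g : G) (n : N), ρ n (ρ g v₀) =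
      (χ₀ ⟨g⁻¹ * ↑n * g, by simpa using hN.conj_mem _ n.2 g⁻¹⟩ : ℂ) • ρ g v₀ := by
    intro g n
    rw [← map_smul, ← hχ₀, ← Module.End.mul_apply, ← Module.End.mul_apply, ← map_mul, ← map_mul]
    congr 2
    simp [mul_assoc]
  refine ⟨χ₀, Set.ext fun χ => ⟨?_, ?_⟩⟩
  · rintro ⟨v, hv, hχ⟩
    by_contra hno
    have hno' : ∀ g : G, ∃ n : N,
        χ n ≠ χ₀ ⟨g⁻¹ * ↑n * g, by simpa using hN.conj_mem _ n.2 g⁻¹⟩ := by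
      intro g
      by_contra h
      push Not at h
      exact hno ⟨g, h⟩
    haveI : Fintype N := Fintype.ofFinite N
    let P : V →ₗ[ℂ] V := ∑ n : N, ((χ n)⁻¹ : ℂˣ).val • ρ n
    have hP : ∀ w, P w = ∑ n : N, ((χ n)⁻¹ : ℂˣ).val • ρ n w := by
      intro w
      simp [P, LinearMap.sum_apply]
    have hPg : ∀ g, P (ρ g v₀) = 0 := by
      intro g
      let f : N →* ℂ :=
        { toFun := fun n => ((χ n)⁻¹ : ℂˣ).val *
            (χ₀ ⟨g⁻¹ * ↑n * g, by simpa using hN.conj_mem _ n.2 g⁻¹⟩ : ℂ)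
          map_one' := by
            have : (⟨g⁻¹ * ↑(1 : N) * g, by simp⟩ : N) = 1 := by
              ext; simp
            rw [this]; simp
          map_mul' := by
            intro a b
            have : (⟨g⁻¹ * ↑(a * b) * g, by simpa using hN.conj_mem _ (a * b).2 g⁻¹⟩ : N) =
              ⟨g⁻¹ * ↑a * g, by simpa using hN.conj_mem _ a.2 g⁻¹⟩ *
              ⟨g⁻¹ * ↑b * g, by simpa using hN.conj_mem _ b.2 g⁻¹⟩ := by
              ext; simp [mul_assoc]
            rw [this, map_mul, map_mul, mul_inv, Units.val_mul, Units.val_mul]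
            ring }
      have hf : f ≠ 1 := by
        intro h
        obtain ⟨n, hn⟩ := hno' g
        apply hn
        have h1 : f n = 1 := by rw [h]; rfl
        have h2 : (χ n)⁻¹ * χ₀ ⟨g⁻¹ * ↑n * g, by simpa using hN.conj_mem _ n.2 g⁻¹⟩ = 1 :=
          Units.ext h1
        exact inv_mul_eq_one.1 h2
      have hs := sum_hom_units_eq_zero f hf
      rw [hP]
      calc _ = ∑ n : N, f n • ρ g v₀ := by
            refine Finset.sum_congr rfl fun n _ => ?_
            rw [key, smul_smul]
            rfl
        _ = 0 := by rw [← Finset.sum_smul, hs, zero_smul]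
    let U : Submodule ℂ V := Submodule.span ℂ (Set.range fun g => ρ g v₀)
    have hU : U = ⊤ := by
      refine (hirr.2 U ?_).resolve_left ?_
      · intro g w hw
        have : U ≤ U.comap (ρ g) := by
          refine Submodule.span_le.2 ?_
          rintro _ ⟨h, rfl⟩
          refine Submodule.subset_span ⟨g * h, ?_⟩
          simp
        exact this hw
      · intro h
        have : v₀ ∈ U := Submodule.subset_span ⟨1, by simp⟩
        rw [h] at this
        exact hv₀ ((Submodule.mem_bot ℂ).1 this)
    have hker : U ≤ LinearMap.ker P := by
      refine Submodule.span_le.2 ?_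
      rintro _ ⟨h, rfl⟩
      exact hPg h
    have hPv : P v = 0 := hker (hU ▸ Submodule.mem_top)
    rw [hP] at hPv
    have h3 : ∀ n : N, ((χ n)⁻¹ : ℂˣ).val • ρ n v = v := by
      intro n
      rw [hχ, smul_smul, Units.inv_mul, one_smul]
    simp only [h3, Finset.sum_const, Finset.card_univ] at hPv
    rw [← Nat.cast_smul_eq_nsmul ℂ] at hPv
    rcases smul_eq_zero.1 hPv with h | h
    · exact Fintype.card_ne_zero (Nat.cast_eq_zero.1 h)
    · exact hv h
  · rintro ⟨g, hg⟩
    refine ⟨ρ g v₀, ?_, fun n => ?_⟩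
    · intro h
      apply hv₀
      have := congrArg (ρ g⁻¹) h
      simpa using this
    · rw [key, hg]
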